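/- arXiv:2311.10355 — 2 statements merged into one kernel-verified Lean document; each statement's English description precedes it below -/
import Mathlib

section
/- Let p > 0 and α ≤ p. Then the function a(t) = t^p / (log(e+t))^α is a strictly increasing continuous bijection of [0, ∞) onto [0, ∞), and there exist constants c₁, c₂ > 0, depending only on p and α, such that c₁ t^{1/p} (log(e+t))^{α/p} ≤ ã(t) ≤ c₂ t^{1/p} (log(e+t))^{α/p} for all t ≥ 0, where ã = a⁻¹ denotes the inverse function of a. -/
open Real Set

/-- a(t) = t^p / (log(e+t))^α. -/
noncomputable def a (p α t : ℝ) : ℝ := t ^ p / Real.log (Real.exp 1 + t) ^ α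

lemma exp_one_add_pos {t : ℝ} (ht : 0 ≤ t) : 0 < Real.exp 1 + t :=
  add_pos_of_pos_of_nonneg (Real.exp_pos 1) ht

lemma one_le_log_exp_one_add {t : ℝ} (ht : 0 ≤ t) : 1 ≤ Real.log (Real.exp 1 + t) := by
  rw [Real.le_log_iff_exp_le (exp_one_add_pos ht)]
  linarith

lemma log_exp_one_add_mono {s t : ℝ} (hs : 0 ≤ s) (hst : s ≤ t) :
    Real.log (Real.exp 1 + s) ≤ Real.log (Real.exp 1 + t) :=
  Real.log_le_log (exp_one_add_pos hs) (by linarith)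

/-- The function `t / log (e + t)` is strictly increasing on `[0, ∞)`. -/
lemma strictMonoOn_div_log_exp_one_add :
    StrictMonoOn (fun t : ℝ => t / Real.log (Real.exp 1 + t)) (Set.Ici 0) := by
  intro s hs t ht hst
  rw [Set.mem_Ici] at hs ht
  have ht0 : 0 < t := hs.trans_lt hst
  have hLs := one_le_log_exp_one_add hs
  have hLt := one_le_log_exp_one_add ht
  have hconc := strictConcaveOn_log_Ioi.concaveOn.2
    (Set.mem_Ioi.2 (exp_one_add_pos ht)) (Set.mem_Ioi.2 (Real.exp_pos 1))
    (div_nonneg hs ht) (sub_nonneg.2 ((div_le_one ht0).2 hst.le)) (by ring)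
  have harg : s / t * (Real.exp 1 + t) + (1 - s / t) * Real.exp 1 = Real.exp 1 + s := by
    field_simp
    ring
  simp only [smul_eq_mul, harg, Real.log_exp, mul_one] at hconc
  have hlt : s / t < 1 := (div_lt_one ht0).2 hst
  have hkey : s / t * Real.log (Real.exp 1 + t) < Real.log (Real.exp 1 + s) := by linarith
  rw [div_mul_eq_mul_div, div_lt_iff₀ ht0] at hkey
  change s / _ < t / _
  rw [div_lt_div_iff₀ (by linarith) (by linarith)]
  linarith

lemma a_eq_mul (p α : ℝ) {t : ℝ} (ht : 0 ≤ t) :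
    a p α t = (t / Real.log (Real.exp 1 + t)) ^ p * Real.log (Real.exp 1 + t) ^ (p - α) := by
  have hL : 0 < Real.log (Real.exp 1 + t) := by linarith [one_le_log_exp_one_add ht]
  have hLp := Real.rpow_pos_of_pos hL p
  have hLα := Real.rpow_pos_of_pos hL α
  rw [a, Real.div_rpow ht hL.le, Real.rpow_sub hL]
  field_simp

lemma a_nonneg (p α : ℝ) {t : ℝ} (ht : 0 ≤ t) : 0 ≤ a p α t :=
  div_nonneg (Real.rpow_nonneg ht p)
    (Real.rpow_nonneg (by linarith [one_le_log_exp_one_add ht]) α)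

lemma strictMonoOn_a {p α : ℝ} (hp : 0 < p) (hα : α ≤ p) :
    StrictMonoOn (a p α) (Set.Ici 0) := by
  intro s hs t ht hst
  have hLs := one_le_log_exp_one_add hs
  have hLt := one_le_log_exp_one_add ht
  rw [a_eq_mul p α hs, a_eq_mul p α ht]
  refine mul_lt_mul
    (Real.rpow_lt_rpow (div_nonneg hs (by linarith))
      (strictMonoOn_div_log_exp_one_add hs ht hst) hp)
    (Real.rpow_le_rpow (by linarith) (log_exp_one_add_mono hs hst.le) (by linarith))
    (Real.rpow_pos_of_pos (by linarith) _)
    (Real.rpow_nonneg (div_nonneg ht (by linarith)) _)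

lemma continuousOn_a {p : ℝ} (hp : 0 ≤ p) (α : ℝ) : ContinuousOn (a p α) (Set.Ici 0) := by
  refine ContinuousOn.div (continuousOn_id.rpow_const fun _ _ => Or.inr hp)
    (ContinuousOn.rpow_const
      (ContinuousOn.log (by fun_prop) fun t ht => (exp_one_add_pos ht).ne') fun t ht =>
        Or.inl (by linarith [one_le_log_exp_one_add ht])) fun t ht =>
    (Real.rpow_pos_of_pos (by linarith [one_le_log_exp_one_add ht]) α).ne'

lemma log_exp_one_add_le_of_le_rpow {x y m : ℝ} (hx : 0 ≤ x) (hy : 0 ≤ y) (hm : 0 ≤ m)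
    (hxy : x ≤ (Real.exp 1 + y) ^ m) :
    Real.log (Real.exp 1 + x) ≤ (m + 2) * Real.log (Real.exp 1 + y) := by
  have hpos := exp_one_add_pos hy
  have he : 2 ≤ Real.exp 1 := by linarith [Real.add_one_le_exp 1]
  have hone : 1 ≤ (Real.exp 1 + y) ^ m := Real.one_le_rpow (by linarith) hm
  rw [← Real.log_rpow hpos]
  refine Real.log_le_log (exp_one_add_pos hx) ?_
  rw [Real.rpow_add hpos, Real.rpow_two]
  nlinarith [mul_nonneg (sub_nonneg.2 hone) hpos.le,
    mul_nonneg (sub_nonneg.2 hone) (mul_nonneg hpos.le hpos.le)]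

lemma log_exp_one_add_a_le {p : ℝ} (hp : 0 ≤ p) (α : ℝ) {s : ℝ} (hs : 0 ≤ s) :
    Real.log (Real.exp 1 + a p α s) ≤ (p + |α| + 2) * Real.log (Real.exp 1 + s) := by
  have hpos := exp_one_add_pos hs
  have hL := one_le_log_exp_one_add hs
  refine log_exp_one_add_le_of_le_rpow (a_nonneg p α hs) hs (by positivity) ?_
  rw [a, div_eq_mul_inv, ← Real.rpow_neg (by linarith), Real.rpow_add hpos]
  gcongr
  · linarith [Real.exp_pos 1]
  · calc Real.log (Real.exp 1 + s) ^ (-α) ≤ Real.log (Real.exp 1 + s) ^ |α| :=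
          Real.rpow_le_rpow_of_exponent_le hL (neg_le_abs α)
      _ ≤ (Real.exp 1 + s) ^ |α| :=
          Real.rpow_le_rpow (by linarith) (Real.log_le_self hpos.le) (abs_nonneg α)

lemma log_exp_one_add_le_two_mul {s : ℝ} (hs : 0 ≤ s) :
    Real.log (Real.exp 1 + s) ≤
      2 * Real.log (Real.exp 1 + s / Real.log (Real.exp 1 + s)) := by
  have hL := one_le_log_exp_one_add hs
  set L := Real.log (Real.exp 1 + s) with hLdef
  have hL0 : 0 < L := by linarith
  have hu : 0 ≤ s / L := div_nonneg hs hL0.le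
  have hle : Real.exp 1 + s ≤ (Real.exp 1 + s / L) * L := by
    rw [add_mul, div_mul_cancel₀ s hL0.ne']
    nlinarith [Real.exp_pos 1]
  have hlog : L ≤ Real.log (Real.exp 1 + s / L) + Real.log L := by
    rw [← Real.log_mul (exp_one_add_pos hu).ne' hL0.ne']
    exact Real.log_le_log (exp_one_add_pos hs) hle
  have hhalf : Real.log L ≤ L / 2 := by
    have h1 := Real.log_le_sub_one_of_pos (half_pos hL0)
    have h2 := Real.log_le_sub_one_of_pos (zero_lt_two (α := ℝ))
    rw [Real.log_div hL0.ne' two_ne_zero] at h1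
    linarith
  linarith

lemma log_exp_one_add_le_log_a {p α : ℝ} (hp : 0 < p) (hα : α ≤ p) {s : ℝ} (hs : 0 ≤ s) :
    Real.log (Real.exp 1 + s) ≤
      2 * (1 / p + 2) * Real.log (Real.exp 1 + a p α s) := by
  have hL := one_le_log_exp_one_add hs
  have ha := a_nonneg p α hs
  have hu : 0 ≤ s / Real.log (Real.exp 1 + s) := div_nonneg hs (by linarith)
  have hua : (s / Real.log (Real.exp 1 + s)) ^ p ≤ Real.exp 1 + a p α s := by
    rw [a_eq_mul p α hs]
    have h1 := Real.one_le_rpow hL (sub_nonneg.2 hα)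
    nlinarith [Real.exp_pos 1, Real.rpow_nonneg hu p]
  have hroot : s / Real.log (Real.exp 1 + s) ≤ (Real.exp 1 + a p α s) ^ (1 / p) := by
    have h := Real.rpow_le_rpow (Real.rpow_nonneg hu p) hua (by positivity : 0 ≤ 1 / p)
    rwa [← Real.rpow_mul hu, mul_one_div_cancel hp.ne', Real.rpow_one] at h
  have hlog := log_exp_one_add_le_of_le_rpow hu ha (by positivity) hroot
  linarith [log_exp_one_add_le_two_mul hs]

/-- Real powers of comparable positive numbers are comparable. -/
lemma rpow_le_rpow_abs_mul_rpow {x y K : ℝ} (hx : 0 < x) (hy : 0 < y) (hK : 0 < K)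
    (hxy : x ≤ K * y) (hyx : y ≤ K * x) (β : ℝ) : x ^ β ≤ K ^ |β| * y ^ β := by
  rcases le_total 0 β with hβ | hβ
  · rw [abs_of_nonneg hβ, ← Real.mul_rpow hK.le hy.le]
    exact Real.rpow_le_rpow hx.le hxy hβ
  · rw [abs_of_nonpos hβ, Real.rpow_neg hK.le, ← Real.inv_rpow hK.le,
      ← Real.mul_rpow (inv_nonneg.2 hK.le) hy.le]
    refine Real.rpow_le_rpow_of_nonpos (by positivity) ?_ hβ
    rwa [inv_mul_le_iff₀ hK]

lemma eq_a_rpow_mul_log_rpow {p : ℝ} (hp : 0 < p) (α : ℝ) {s : ℝ} (hs : 0 ≤ s) :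
    s = a p α s ^ (1 / p) * Real.log (Real.exp 1 + s) ^ (α / p) := by
  have hL : 0 < Real.log (Real.exp 1 + s) := by linarith [one_le_log_exp_one_add hs]
  rw [a, Real.div_rpow (Real.rpow_nonneg hs p) (Real.rpow_nonneg hL.le α), ← Real.rpow_mul hs,
    ← Real.rpow_mul hL.le, mul_one_div_cancel hp.ne', Real.rpow_one, mul_one_div,
    div_mul_cancel₀ _ (Real.rpow_pos_of_pos hL _).ne']

/-- For p > 0 and α ≤ p, the function a(t) = t^p/(log(e+t))^α is a
strictly increasing continuous bijection of [0,∞) onto [0,∞), and its inverse ã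
satisfies c₁ t^{1/p}(log(e+t))^{α/p} ≤ ã(t) ≤ c₂ t^{1/p}(log(e+t))^{α/p}
for all t ≥ 0, for some constants c₁, c₂ > 0 depending only on p and α. -/
theorem a_bijective_and_inverse_bounds (p α : ℝ) (hp : 0 < p) (hα : α ≤ p)
    (atil : ℝ → ℝ) (hmaps : Set.MapsTo atil (Set.Ici 0) (Set.Ici 0))
    (hinv : Set.InvOn atil (a p α) (Set.Ici 0) (Set.Ici 0)) :
    StrictMonoOn (a p α) (Set.Ici 0) ∧
    ContinuousOn (a p α) (Set.Ici 0) ∧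
    Set.BijOn (a p α) (Set.Ici 0) (Set.Ici 0) ∧
    ∃ c₁ c₂ : ℝ, 0 < c₁ ∧ 0 < c₂ ∧ ∀ t : ℝ, 0 ≤ t →
      c₁ * t ^ (1 / p) * Real.log (Real.exp 1 + t) ^ (α / p) ≤ atil t ∧
      atil t ≤ c₂ * t ^ (1 / p) * Real.log (Real.exp 1 + t) ^ (α / p) := by
  have hmono := strictMonoOn_a hp hα
  refine ⟨hmono, continuousOn_a hp.le α, hinv.bijOn (fun t ht => a_nonneg p α ht) hmaps, ?_⟩
  set K : ℝ := p + |α| + 2 + 2 * (1 / p + 2) with hKdef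
  have hp' : 0 < 1 / p := by positivity
  have hK : 0 < K := by positivity
  have hKβ : 0 < K ^ |α / p| := Real.rpow_pos_of_pos hK _
  refine ⟨(K ^ |α / p|)⁻¹, K ^ |α / p|, inv_pos.2 hKβ, hKβ, fun t ht => ?_⟩
  have hs : 0 ≤ atil t := hmaps ht
  have has : a p α (atil t) = t := hinv.2 ht
  have heq := eq_a_rpow_mul_log_rpow hp α hs
  have hup := log_exp_one_add_a_le hp.le α hs
  have hlow := log_exp_one_add_le_log_a hp hα hs
  rw [has] at heq hup hlow
  have hLs : 0 < Real.log (Real.exp 1 + atil t) := by linarith [one_le_log_exp_one_add hs]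
  have hLt : 0 < Real.log (Real.exp 1 + t) := by linarith [one_le_log_exp_one_add ht]
  have hts : Real.log (Real.exp 1 + t) ≤ K * Real.log (Real.exp 1 + atil t) :=
    hup.trans (mul_le_mul_of_nonneg_right (by linarith) hLs.le)
  have hst : Real.log (Real.exp 1 + atil t) ≤ K * Real.log (Real.exp 1 + t) :=
    hlow.trans (mul_le_mul_of_nonneg_right (by linarith [abs_nonneg α]) hLt.le)
  have htp : 0 ≤ t ^ (1 / p) := Real.rpow_nonneg ht _
  constructor
  · rw [mul_assoc, inv_mul_le_iff₀ hKβ]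
    calc t ^ (1 / p) * Real.log (Real.exp 1 + t) ^ (α / p)
        ≤ t ^ (1 / p) * (K ^ |α / p| * Real.log (Real.exp 1 + atil t) ^ (α / p)) :=
          mul_le_mul_of_nonneg_left (rpow_le_rpow_abs_mul_rpow hLt hLs hK hts hst _) htp
      _ = K ^ |α / p| * (t ^ (1 / p) * Real.log (Real.exp 1 + atil t) ^ (α / p)) := by ring
      _ = K ^ |α / p| * atil t := by rw [← heq]
  · calc atil t = t ^ (1 / p) * Real.log (Real.exp 1 + atil t) ^ (α / p) := heq
      _ ≤ t ^ (1 / p) * (K ^ |α / p| * Real.log (Real.exp 1 + t) ^ (α / p)) :=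
          mul_le_mul_of_nonneg_left (rpow_le_rpow_abs_mul_rpow hLs hLt hK hst hts _) htp
      _ = K ^ |α / p| * t ^ (1 / p) * Real.log (Real.exp 1 + t) ^ (α / p) := by ring
end

section
/- Let p > 0 and α < 0. Then for every ε ∈ (0, 1/p) there exist constants C₁, C₂ > 0 such that Ã(s) ≥ C₁ s^{(p+1)/p − ε} − C₂ for all s ≥ 0. -/
open Real Set

/-- Ã(t) = ∫₀ᵗ ã(s) ds, where ã is a given function (intended as a⁻¹). -/
noncomputable def Atilde (atil : ℝ → ℝ) (t : ℝ) : ℝ := ∫ s in (0:ℝ)..t, atil s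

theorem log_exp_one_add_pos {t : ℝ} (ht : 0 ≤ t) : 0 < Real.log (Real.exp 1 + t) :=
  Real.log_pos (by linarith [Real.add_one_lt_exp one_ne_zero])

theorem monotoneOn_a {p α : ℝ} (hp : 0 ≤ p) (hα : α ≤ 0) : MonotoneOn (a p α) (Ici 0) := by
  intro x hx y hy hxy
  have hx : 0 ≤ x := hx
  have hy : 0 ≤ y := hy
  have hlog : Real.log (Real.exp 1 + x) ≤ Real.log (Real.exp 1 + y) :=
    Real.log_le_log (by positivity) (by linarith)
  exact div_le_div₀ (by positivity) (Real.rpow_le_rpow hx hxy hp)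
    (Real.rpow_pos_of_pos (log_exp_one_add_pos hy) _)
    (Real.rpow_le_rpow_of_nonpos (log_exp_one_add_pos hx) hlog hα)

/-- A right inverse of a monotone function is monotone. -/
theorem monotoneOn_of_rightInvOn {f g : ℝ → ℝ} {s t : Set ℝ} (hf : MonotoneOn f s)
    (hg : MapsTo g t s) (hfg : RightInvOn g f t) : MonotoneOn g t := by
  intro x hx y hy hxy
  by_contra! h
  have hle := hf (hg hy) (hg hx) h.le
  rw [hfg hx, hfg hy] at hle
  rw [le_antisymm hxy hle] at h
  exact lt_irrefl _ h

/-- For `α < 0` the logarithmic factor costs an arbitrarily small power. -/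
theorem exists_a_le_rpow {p α r : ℝ} (hp : 0 < p) (hα : α < 0) (hr : p < r) :
    ∃ M : ℝ, 0 < M ∧ ∀ t : ℝ, 0 ≤ t → a p α t ≤ M * (Real.exp 1 + t) ^ r := by
  have hδ : 0 < (r - p) / -α := div_pos (by linarith) (by linarith)
  set δ := (r - p) / -α with hδ_def
  refine ⟨(1 / δ) ^ (-α), by positivity, fun t ht => ?_⟩
  have hE : 0 < Real.exp 1 + t := by positivity
  have hlog := log_exp_one_add_pos ht
  calc a p α t = t ^ p * Real.log (Real.exp 1 + t) ^ (-α) := by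
        rw [a, Real.rpow_neg hlog.le, div_eq_mul_inv]
    _ ≤ (Real.exp 1 + t) ^ p * ((Real.exp 1 + t) ^ δ / δ) ^ (-α) := by
        gcongr
        · linarith [Real.exp_pos 1]
        · linarith
        · exact Real.log_le_rpow_div hE.le hδ
    _ = (1 / δ) ^ (-α) * (Real.exp 1 + t) ^ r := by
        have hexp : δ * -α = r - p := by
          rw [hδ_def]
          exact div_mul_cancel₀ _ (by linarith)
        rw [div_eq_mul_one_div, Real.mul_rpow (by positivity) (by positivity),
          ← Real.rpow_mul hE.le, hexp, ← mul_assoc, ← Real.rpow_add hE, add_sub_cancel, mul_comm]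

/-- A linear term is absorbed by a superlinear power, up to an additive constant. -/
theorem exists_mul_le_rpow_add {b c q : ℝ} (hb : 0 < b) (hc : 0 < c) (hq : 0 < q) :
    ∃ C : ℝ, 0 < C ∧ ∀ s : ℝ, 0 ≤ s → b * s ≤ c * s ^ (q + 1) + C := by
  refine ⟨b * (b / c) ^ q⁻¹, by positivity, fun s hs => ?_⟩
  rcases le_total s ((b / c) ^ q⁻¹) with h | h
  · have h₁ : b * s ≤ b * (b / c) ^ q⁻¹ := by gcongr
    have h₂ : 0 ≤ c * s ^ (q + 1) := by positivity
    linarith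
  · have h₁ : b / c ≤ s ^ q := by
      calc b / c = ((b / c) ^ q⁻¹) ^ q := (Real.rpow_inv_rpow (by positivity) hq.ne').symm
        _ ≤ s ^ q := Real.rpow_le_rpow (by positivity) h hq.le
    have h₂ : b ≤ c * s ^ q := by
      rw [div_le_iff₀ hc] at h₁
      linarith
    have h₃ : b * s ≤ c * s ^ (q + 1) := by
      rw [Real.rpow_add_one' hs (by linarith), ← mul_assoc]
      gcongr
    have h₄ : 0 < b * (b / c) ^ q⁻¹ := by positivity
    linarith

/-- For p > 0 and α < 0, for every ε ∈ (0, 1/p) there exist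
constants C₁, C₂ > 0 such that Ã(s) ≥ C₁ s^{(p+1)/p − ε} − C₂ for all s ≥ 0. -/
theorem Atilde_lower_bound_neg_alpha (p α : ℝ) (hp : 0 < p) (hα : α < 0)
    (atil : ℝ → ℝ) (hmaps : Set.MapsTo atil (Set.Ici 0) (Set.Ici 0))
    (hinv : Set.InvOn atil (a p α) (Set.Ici 0) (Set.Ici 0)) :
    ∀ ε : ℝ, 0 < ε → ε < 1 / p →
      ∃ C₁ C₂ : ℝ, 0 < C₁ ∧ 0 < C₂ ∧ ∀ s : ℝ, 0 ≤ s →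
        C₁ * s ^ ((p + 1) / p - ε) - C₂ ≤ Atilde atil s := by
  intro ε hε hεp
  obtain ⟨q, hq_def⟩ : ∃ q, q = 1 / p - ε := ⟨_, rfl⟩
  have hq : 0 < q := by linarith
  have hexp : (p + 1) / p - ε = q + 1 := by
    rw [hq_def]
    field_simp
    ring
  have hr : p < q⁻¹ := by
    rw [lt_inv_comm₀ hp hq, ← one_div]
    linarith
  obtain ⟨M, hM, haM⟩ := exists_a_le_rpow hp hα hr
  have hmono : MonotoneOn atil (Ici 0) :=
    monotoneOn_of_rightInvOn (monotoneOn_a hp.le hα.le) hmaps hinv.2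
  have hpt : ∀ s : ℝ, 0 ≤ s → (M ^ q)⁻¹ * s ^ q - Real.exp 1 ≤ atil s := by
    intro s hs
    have ht : 0 ≤ atil s := hmaps hs
    have hE : 0 ≤ Real.exp 1 + atil s := by positivity
    have hle := haM (atil s) ht
    rw [hinv.2 hs] at hle
    have hpow : s ^ q ≤ M ^ q * (Real.exp 1 + atil s) := by
      calc s ^ q ≤ (M * (Real.exp 1 + atil s) ^ q⁻¹) ^ q := Real.rpow_le_rpow hs hle hq.le
        _ = M ^ q * (Real.exp 1 + atil s) := by
          rw [Real.mul_rpow hM.le (by positivity), Real.rpow_inv_rpow hE hq.ne']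
    have := (inv_mul_le_iff₀ (by positivity : 0 < M ^ q)).2 hpow
    linarith
  obtain ⟨c, hc_def⟩ : ∃ c, c = (M ^ q)⁻¹ / (q + 1) / 2 := ⟨_, rfl⟩
  have hc : 0 < c := by
    rw [hc_def]
    positivity
  obtain ⟨C, hC, hlin⟩ := exists_mul_le_rpow_add (Real.exp_pos 1) hc hq
  refine ⟨c, C, hc, hC, fun s hs => ?_⟩
  have hpow_int : IntervalIntegrable (fun x : ℝ => (M ^ q)⁻¹ * x ^ q) MeasureTheory.volume 0 s :=
    (intervalIntegral.intervalIntegrable_rpow' (by linarith)).const_mul _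
  have hatil_int : IntervalIntegrable atil MeasureTheory.volume 0 s := by
    apply MonotoneOn.intervalIntegrable
    rw [uIcc_of_le hs]
    exact hmono.mono Icc_subset_Ici_self
  have hint : ∫ x in (0 : ℝ)..s, ((M ^ q)⁻¹ * x ^ q - Real.exp 1) ≤ Atilde atil s :=
    intervalIntegral.integral_mono_on hs (hpow_int.sub intervalIntegrable_const) hatil_int
      fun x hx => hpt x hx.1
  rw [intervalIntegral.integral_sub hpow_int intervalIntegrable_const,
    intervalIntegral.integral_const_mul, integral_rpow (Or.inl (by linarith)),
    intervalIntegral.integral_const, Real.zero_rpow (by linarith), smul_eq_mul, sub_zero,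
    sub_zero] at hint
  have hsplit : (M ^ q)⁻¹ * (s ^ (q + 1) / (q + 1)) = 2 * (c * s ^ (q + 1)) := by
    rw [hc_def]
    ring
  rw [hexp]
  linarith [hlin s hs]
end
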